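/- Let X be a coloured random graph with colour law μ : 𝒳 → (0,1] and connection probabilities p_n satisfying a_n^{-1}·p_n(a,b) → C(a,b) for all a,b ∈ 𝒳, for some symmetric C : 𝒳×𝒳 → [0,∞) and a sequence (a_n) with a_n → 0 and n·a_n → ∞. Then the pair (L¹, L²) satisfies a large deviation principle in ℳ(𝒳)×ℳ̃_*(𝒳×𝒳) with speed n and good rate function I₂(ω,ϖ) = H(ω‖μ) if ϖ = Cω⊗ω, and I₂(ω,ϖ) = +∞ otherwise. -/

import Mathlib

open Filter
open scoped ENNReal

noncomputable section

namespace CRG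

variable {𝒳 : Type} [Fintype 𝒳] [DecidableEq 𝒳]

/-- The set `ℰ` of formally ordered potential edges on `{1,…,n}`. -/
abbrev Edges (n : ℕ) : Finset (Fin n × Fin n) :=
  Finset.univ.filter (fun e : Fin n × Fin n => e.1 < e.2)

/-- The probability weight `P_n(x)` of a coloured graph `x` (colouring, edge set) under the
coloured random graph law with colour law `μ` and connection probabilities `p`. -/
def graphWeight (μ : 𝒳 → ℝ) (p : 𝒳 → 𝒳 → ℝ) (n : ℕ)
    (x : (Fin n → 𝒳) × Finset (Fin n × Fin n)) : ℝ :=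
  (if x.2 ⊆ Edges n then 1 else 0) *
  (∏ v, μ (x.1 v)) *
  ∏ e ∈ Edges n, (if e ∈ x.2 then p (x.1 e.1) (x.1 e.2) else 1 - p (x.1 e.1) (x.1 e.2))

/-- The probability `ℙ_n(S)` of an event `S` under the coloured random graph law. -/
def graphPr (μ : 𝒳 → ℝ) (p : 𝒳 → 𝒳 → ℝ) (n : ℕ)
    (S : Set ((Fin n → 𝒳) × Finset (Fin n × Fin n))) : ℝ :=
  ∑ x, S.indicator (graphWeight μ p n) x

/-- The empirical colour measure `L¹`. -/
def L1 (n : ℕ) (x : (Fin n → 𝒳) × Finset (Fin n × Fin n)) (a : 𝒳) : ℝ :=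
  ((Finset.univ.filter (fun v : Fin n => x.1 v = a)).card : ℝ) / n

/-- The empirical pair measure `L²` (scaled by `1/(n² aₙ)`). -/
def L2 (an : ℝ) (n : ℕ) (x : (Fin n → 𝒳) × Finset (Fin n × Fin n)) (q : 𝒳 × 𝒳) : ℝ :=
  (∑ e ∈ x.2, ((if (x.1 e.1, x.1 e.2) = q then (1:ℝ) else 0)
    + (if (x.1 e.2, x.1 e.1) = q then (1:ℝ) else 0))) / ((n:ℝ)^2 * an)

/-- Extended-real logarithm, `log 0 = -∞`. -/
def elog (x : ℝ) : EReal := if x ≤ 0 then ⊥ else ((Real.log x : ℝ) : EReal)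

/-- `ℳ(𝒳) × ℳ̃_*(𝒳×𝒳)`: probability vectors paired with finite symmetric measures,
viewed inside `ℝ^𝒳 × ℝ^(𝒳×𝒳)`. -/
def MSpace (𝒳 : Type) [Fintype 𝒳] : Set ((𝒳 → ℝ) × (𝒳 × 𝒳 → ℝ)) :=
  {z | (∀ a, 0 ≤ z.1 a) ∧ (∑ a, z.1 a) = 1 ∧ (∀ q, 0 ≤ z.2 q) ∧ ∀ a b, z.2 (a,b) = z.2 (b,a)}

open Classical in
/-- Relative entropy `H(ν‖ρ)` of measures on a finite set, `+∞` if `ν` is not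
absolutely continuous w.r.t. `ρ`. -/
def relEnt (ν ρ : 𝒳 → ℝ) : ℝ≥0∞ :=
  if ∀ x, ρ x = 0 → ν x = 0 then
    ENNReal.ofReal (∑ x, ν x * Real.log (ν x / ρ x)) else ⊤

open Classical in
/-- `𝔥_C(ϖ‖ω) = H(ϖ‖Cω⊗ω) + ‖Cω⊗ω‖ − ‖ϖ‖`. -/
def hRel (C : 𝒳 → 𝒳 → ℝ) (ω : 𝒳 → ℝ) (ϖ : 𝒳 × 𝒳 → ℝ) : ℝ≥0∞ :=
  if ∀ q : 𝒳 × 𝒳, C q.1 q.2 * ω q.1 * ω q.2 = 0 → ϖ q = 0 then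
    ENNReal.ofReal ((∑ q : 𝒳 × 𝒳, ϖ q * Real.log (ϖ q / (C q.1 q.2 * ω q.1 * ω q.2)))
      + (∑ q : 𝒳 × 𝒳, C q.1 q.2 * ω q.1 * ω q.2) - ∑ q : 𝒳 × 𝒳, ϖ q)
  else ⊤

end CRG

open CRG

open Classical in
/-- The rate function `I₂(ω,ϖ) = H(ω‖μ)` if `ϖ = Cω⊗ω`, `+∞` otherwise. -/
def I2 {𝒳 : Type} [Fintype 𝒳] (μ : 𝒳 → ℝ) (C : 𝒳 → 𝒳 → ℝ)
    (z : (𝒳 → ℝ) × (𝒳 × 𝒳 → ℝ)) : ℝ≥0∞ :=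
  if z.2 = (fun q : 𝒳 × 𝒳 => C q.1 q.2 * z.1 q.1 * z.1 q.2) then relEnt z.1 μ else ⊤

namespace CRG

variable {𝒳 : Type}

/-! ### Exponential moments -/

lemma exp_le_one_add_add_sq {x : ℝ} (hx : |x| ≤ 1) : Real.exp x ≤ 1 + x + x ^ 2 := by
  have := (abs_le.1 (Real.abs_exp_sub_one_sub_id_le hx)).2
  linarith

lemma sum_powerset_bernoulli {ι : Type*} [DecidableEq ι] (s : Finset ι) (r : ι → ℝ) :
    ∑ E ∈ s.powerset, ((∏ e ∈ E, r e) * ∏ e ∈ s \ E, (1 - r e)) = 1 := by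
  rw [← Finset.prod_add]
  simp

/-- Exponential moment bound for a weighted sum of independent Bernoulli variables. -/
lemma sum_powerset_bernoulli_exp_le {ι : Type*} [DecidableEq ι] (s : Finset ι) (r w : ι → ℝ)
    (hr0 : ∀ e, 0 ≤ r e) (hr1 : ∀ e, r e ≤ 1) (t : ℝ) (hw : ∀ e, |t * w e| ≤ 1) :
    ∑ E ∈ s.powerset, ((∏ e ∈ E, r e) * ∏ e ∈ s \ E, (1 - r e)) *
      Real.exp (t * (∑ e ∈ E, w e - ∑ e ∈ s, r e * w e)) ≤
    Real.exp (t ^ 2 * ∑ e ∈ s, r e * w e ^ 2) := by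
  have h1 : ∀ E, ((∏ e ∈ E, r e) * ∏ e ∈ s \ E, (1 - r e)) *
      Real.exp (t * (∑ e ∈ E, w e - ∑ e ∈ s, r e * w e)) =
      ((∏ e ∈ E, r e * Real.exp (t * w e)) * ∏ e ∈ s \ E, (1 - r e)) *
        Real.exp (- (t * ∑ e ∈ s, r e * w e)) := by
    intro E
    rw [Finset.prod_mul_distrib, ← Real.exp_sum, ← Finset.mul_sum, mul_sub, sub_eq_add_neg,
      Real.exp_add]
    ring
  simp_rw [h1]
  rw [← Finset.sum_mul, ← Finset.prod_add]
  have h2 : ∏ e ∈ s, (r e * Real.exp (t * w e) + (1 - r e)) ≤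
      ∏ e ∈ s, Real.exp (t * (r e * w e) + t ^ 2 * (r e * w e ^ 2)) := by
    apply Finset.prod_le_prod
    · intro e _
      have := mul_nonneg (hr0 e) (Real.exp_pos (t * w e)).le
      linarith [hr1 e]
    · intro e _
      have := mul_le_mul_of_nonneg_left (exp_le_one_add_add_sq (hw e)) (hr0 e)
      refine le_trans ?_ (Real.add_one_le_exp _)
      nlinarith
  calc _ ≤ _ := mul_le_mul_of_nonneg_right h2 (Real.exp_pos _).le
    _ = _ := by
      rw [← Real.exp_sum, ← Real.exp_add, Finset.sum_add_distrib, ← Finset.mul_sum,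
        ← Finset.mul_sum]
      congr 1
      ring

/-! ### The law of the coloured random graph -/

lemma graphWeight_nonneg {ν : 𝒳 → ℝ} {p : 𝒳 → 𝒳 → ℝ} (hν : ∀ a, 0 ≤ ν a)
    (hp0 : ∀ a b, 0 ≤ p a b) (hp1 : ∀ a b, p a b ≤ 1) (n : ℕ)
    (x : (Fin n → 𝒳) × Finset (Fin n × Fin n)) : 0 ≤ graphWeight ν p n x := by
  unfold graphWeight
  refine mul_nonneg (mul_nonneg (by split_ifs <;> norm_num)
    (Finset.prod_nonneg fun v _ => hν _)) (Finset.prod_nonneg fun e _ => ?_)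
  split_ifs
  · exact hp0 _ _
  · linarith [hp1 (x.1 e.1) (x.1 e.2)]

variable [Fintype 𝒳]

lemma sum_graphWeight_mul (ν : 𝒳 → ℝ) (p : 𝒳 → 𝒳 → ℝ) (n : ℕ)
    (G : (Fin n → 𝒳) × Finset (Fin n × Fin n) → ℝ) :
    ∑ x, graphWeight ν p n x * G x =
      ∑ f : Fin n → 𝒳, (∏ v, ν (f v)) * ∑ E ∈ (Edges n).powerset,
        ((∏ e ∈ E, p (f e.1) (f e.2)) * ∏ e ∈ Edges n \ E, (1 - p (f e.1) (f e.2))) *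
          G (f, E) := by
  rw [Fintype.sum_prod_type]
  refine Finset.sum_congr rfl fun f _ => ?_
  rw [Finset.mul_sum]
  symm
  apply Finset.sum_subset_zero_on_sdiff (Finset.subset_univ _)
  · intro E hE
    have : ¬ E ⊆ Edges n := by simpa using hE
    simp only [graphWeight]
    rw [if_neg this]
    simp
  · intro E hE
    have hE' : E ⊆ Edges n := Finset.mem_powerset.1 hE
    simp only [graphWeight]
    rw [if_pos hE', Finset.prod_ite]
    have e1 : (Edges n).filter (fun e => e ∈ E) = E := by
      ext e
      simp only [Finset.mem_filter]
      exact ⟨fun h => h.2, fun h => ⟨by simpa using hE' h, h⟩⟩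
    have e2 : (Edges n).filter (fun e => e ∉ E) = Edges n \ E := by
      ext e
      simp only [Finset.mem_filter, Finset.mem_sdiff]
    rw [e1, e2]
    ring

lemma graphPr_eq (ν : 𝒳 → ℝ) (p : 𝒳 → 𝒳 → ℝ) (n : ℕ)
    (S : Set ((Fin n → 𝒳) × Finset (Fin n × Fin n))) :
    graphPr ν p n S = ∑ x, graphWeight ν p n x * S.indicator 1 x := by
  classical
  unfold graphPr
  refine Finset.sum_congr rfl fun x _ => ?_
  by_cases h : x ∈ S <;> simp [h]

lemma sum_graphWeight_mul_colour (ν : 𝒳 → ℝ) (p : 𝒳 → 𝒳 → ℝ) (n : ℕ)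
    (g : (Fin n → 𝒳) → ℝ) :
    ∑ x, graphWeight ν p n x * g x.1 = ∑ f : Fin n → 𝒳, (∏ v, ν (f v)) * g f := by
  rw [sum_graphWeight_mul ν p n (fun x => g x.1)]
  refine Finset.sum_congr rfl fun f _ => ?_
  dsimp only
  rw [← Finset.sum_mul, sum_powerset_bernoulli, one_mul]

lemma sum_prod_colour (n : ℕ) (g : 𝒳 → ℝ) :
    ∑ f : Fin n → 𝒳, ∏ v, g (f v) = (∑ c, g c) ^ n := by
  have := (Finset.prod_univ_sum (fun _ : Fin n => (Finset.univ : Finset 𝒳)) (fun _ c => g c)).symm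
  simpa using this

lemma graphPr_univ (ν : 𝒳 → ℝ) (hν : ∑ c, ν c = 1) (p : 𝒳 → 𝒳 → ℝ) (n : ℕ) :
    graphPr ν p n Set.univ = 1 := by
  rw [graphPr_eq]
  have := sum_graphWeight_mul_colour ν p n (fun _ => 1)
  simp only [mul_one, sum_prod_colour, hν, one_pow] at this
  simpa using this

lemma graphPr_le_sum {ν : 𝒳 → ℝ} {p : 𝒳 → 𝒳 → ℝ} (hν : ∀ a, 0 ≤ ν a)
    (hp0 : ∀ a b, 0 ≤ p a b) (hp1 : ∀ a b, p a b ≤ 1) {n : ℕ}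
    {S : Set ((Fin n → 𝒳) × Finset (Fin n × Fin n))}
    {G : (Fin n → 𝒳) × Finset (Fin n × Fin n) → ℝ} (hG0 : ∀ x, 0 ≤ G x)
    (hG : ∀ x ∈ S, 1 ≤ G x) : graphPr ν p n S ≤ ∑ x, graphWeight ν p n x * G x := by
  classical
  rw [graphPr_eq]
  refine Finset.sum_le_sum fun x _ =>
    mul_le_mul_of_nonneg_left ?_ (graphWeight_nonneg hν hp0 hp1 n x)
  by_cases h : x ∈ S <;> simp [h, hG0, hG]

lemma graphPr_le_sum_graphPr {ν : 𝒳 → ℝ} {p : 𝒳 → 𝒳 → ℝ} (hν : ∀ a, 0 ≤ ν a)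
    (hp0 : ∀ a b, 0 ≤ p a b) (hp1 : ∀ a b, p a b ≤ 1) {n : ℕ}
    {S : Set ((Fin n → 𝒳) × Finset (Fin n × Fin n))}
    {ι : Type*} [Fintype ι]
    (T : ι → Set ((Fin n → 𝒳) × Finset (Fin n × Fin n))) (h : ∀ x ∈ S, ∃ i, x ∈ T i) :
    graphPr ν p n S ≤ ∑ i, graphPr ν p n (T i) := by
  classical
  refine (graphPr_le_sum hν hp0 hp1 (G := fun x => ∑ i, (T i).indicator (fun _ => (1 : ℝ)) x) ?_ ?_).trans_eq ?_
  · exact fun x => Finset.sum_nonneg fun i _ => Set.indicator_nonneg (fun _ _ => zero_le_one) x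
  · intro x hx
    obtain ⟨i, hi⟩ := h x hx
    have := Finset.single_le_sum (f := fun i => (T i).indicator (fun _ => (1 : ℝ)) x)
      (fun i _ => Set.indicator_nonneg (fun _ _ => zero_le_one) x) (Finset.mem_univ i)
    simpa [hi] using this
  · simp_rw [graphPr_eq, Finset.mul_sum]
    rw [Finset.sum_comm]
    rfl

lemma graphPr_le_add {ν : 𝒳 → ℝ} {p : 𝒳 → 𝒳 → ℝ} (hν : ∀ a, 0 ≤ ν a)
    (hp0 : ∀ a b, 0 ≤ p a b) (hp1 : ∀ a b, p a b ≤ 1) {n : ℕ}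
    {S : Set ((Fin n → 𝒳) × Finset (Fin n × Fin n))}
    (T T' : Set ((Fin n → 𝒳) × Finset (Fin n × Fin n)))
    (h : ∀ x ∈ S, x ∈ T ∨ x ∈ T') :
    graphPr ν p n S ≤ graphPr ν p n T + graphPr ν p n T' := by
  refine (graphPr_le_sum_graphPr hν hp0 hp1 (fun b : Bool => if b then T else T') ?_).trans_eq ?_
  · intro x hx
    rcases h x hx with h | h
    · exact ⟨true, by simpa using h⟩
    · exact ⟨false, by simpa using h⟩
  · simp

end CRG
namespace CRG

variable {𝒳 : Type} [DecidableEq 𝒳]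

/-! ### Concentration of the empirical pair measure given the colours -/

/-- The contribution of a potential edge `e` to the pair count of `q` under the colouring `f`. -/
def pairCount {n : ℕ} (f : Fin n → 𝒳) (q : 𝒳 × 𝒳) (e : Fin n × Fin n) : ℝ :=
  (if (f e.1, f e.2) = q then (1:ℝ) else 0) + (if (f e.2, f e.1) = q then (1:ℝ) else 0)

/-- The conditional expectation of `L2` given the colouring `f`. -/
def condMean (p : 𝒳 → 𝒳 → ℝ) (an : ℝ) (n : ℕ) (f : Fin n → 𝒳) (q : 𝒳 × 𝒳) : ℝ :=
  (∑ e ∈ Edges n, p (f e.1) (f e.2) * pairCount f q e) / ((n:ℝ)^2 * an)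

lemma pairCount_nonneg {n : ℕ} (f : Fin n → 𝒳) (q : 𝒳 × 𝒳) (e : Fin n × Fin n) :
    0 ≤ pairCount f q e := by
  unfold pairCount
  split_ifs <;> norm_num

lemma pairCount_le {n : ℕ} (f : Fin n → 𝒳) (q : 𝒳 × 𝒳) (e : Fin n × Fin n) :
    pairCount f q e ≤ 2 := by
  unfold pairCount
  split_ifs <;> norm_num

lemma L1_le_one {n : ℕ} (x : (Fin n → 𝒳) × Finset (Fin n × Fin n)) (c : 𝒳) :
    L1 n x c ≤ 1 := by
  unfold L1
  apply div_le_one_of_le₀ _ (Nat.cast_nonneg n)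
  have := Finset.card_le_univ (Finset.univ.filter (fun v : Fin n => x.1 v = c))
  rw [Fintype.card_fin] at this
  exact_mod_cast this

lemma L1_nonneg {n : ℕ} (x : (Fin n → 𝒳) × Finset (Fin n × Fin n)) (c : 𝒳) :
    0 ≤ L1 n x c := by
  unfold L1
  positivity

lemma L1_colour_pos {n : ℕ}
    (x : (Fin n → 𝒳) × Finset (Fin n × Fin n)) (v : Fin n) : 0 < L1 n x (x.1 v) := by
  unfold L1
  have : 0 < (Finset.univ.filter (fun u : Fin n => x.1 u = x.1 v)).card :=
    Finset.card_pos.2 ⟨v, by simp⟩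
  have hn : 0 < n := v.pos
  positivity

lemma sum_edges_pairCount {n : ℕ} (f : Fin n → 𝒳) (q : 𝒳 × 𝒳) :
    ∃ d : ℝ, 0 ≤ d ∧ d ≤ n ∧ ∑ e ∈ Edges n, pairCount f q e =
      ((Finset.univ.filter (fun v : Fin n => f v = q.1)).card : ℝ) *
      ((Finset.univ.filter (fun v : Fin n => f v = q.2)).card : ℝ) - d := by
  let g : Fin n × Fin n → ℝ := fun e => if (f e.1, f e.2) = q then (1:ℝ) else 0
  refine ⟨∑ e ∈ Finset.univ.filter (fun e : Fin n × Fin n => e.1 = e.2), g e, ?_, ?_, ?_⟩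
  · exact Finset.sum_nonneg fun e _ => by simp only [g]; split_ifs <;> norm_num
  · calc _ ≤ ∑ e ∈ Finset.univ.filter (fun e : Fin n × Fin n => e.1 = e.2), (1 : ℝ) :=
          Finset.sum_le_sum fun e _ => by simp only [g]; split_ifs <;> norm_num
      _ = n := by
          rw [Finset.sum_filter, Fintype.sum_prod_type]
          simp
  · have htot : ((Finset.univ.filter (fun v : Fin n => f v = q.1)).card : ℝ) *
        ((Finset.univ.filter (fun v : Fin n => f v = q.2)).card : ℝ) = ∑ e, g e := by
      rw [Finset.card_filter, Finset.card_filter, Fintype.sum_prod_type]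
      push_cast
      rw [Finset.sum_mul_sum]
      refine Finset.sum_congr rfl fun u _ => Finset.sum_congr rfl fun v _ => ?_
      simp only [g, Prod.ext_iff]
      by_cases h1 : f u = q.1 <;> by_cases h2 : f v = q.2 <;> simp [h1, h2]
    have hswap : ∑ e ∈ Edges n, (if (f e.2, f e.1) = q then (1:ℝ) else 0) =
        ∑ e ∈ Finset.univ.filter (fun e : Fin n × Fin n => e.2 < e.1), g e :=
      Finset.sum_equiv (Equiv.prodComm _ _) (by simp) (by simp [g])
    simp only [pairCount]
    rw [Finset.sum_add_distrib, hswap, htot, Finset.sum_filter, Finset.sum_filter,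
      Finset.sum_filter, eq_sub_iff_add_eq, ← Finset.sum_add_distrib, ← Finset.sum_add_distrib]
    refine Finset.sum_congr rfl fun e _ => ?_
    rcases lt_trichotomy e.1 e.2 with h | h | h
    · simp [h, h.not_gt, h.ne, g]
    · simp [h, g]
    · simp [h, h.not_gt, h.ne', g]

lemma abs_condMean_sub_le {p C : 𝒳 → 𝒳 → ℝ} (hpsymm : ∀ a b, p a b = p b a)
    {an B : ℝ} (han : 0 < an) {n : ℕ} (hn : 0 < n) (q : 𝒳 × 𝒳)
    (hp0 : 0 ≤ p q.1 q.2) (hB : p q.1 q.2 / an ≤ B)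
    (x : (Fin n → 𝒳) × Finset (Fin n × Fin n)) :
    |condMean p an n x.1 q - C q.1 q.2 * L1 n x q.1 * L1 n x q.2| ≤
      |p q.1 q.2 / an - C q.1 q.2| + B / n := by
  have hn' : (0:ℝ) < n := by exact_mod_cast hn
  obtain ⟨d, hd0, hdn, hd⟩ := sum_edges_pairCount x.1 q
  have h1 : ∑ e ∈ Edges n, p (x.1 e.1) (x.1 e.2) * pairCount x.1 q e =
      p q.1 q.2 * ∑ e ∈ Edges n, pairCount x.1 q e := by
    rw [Finset.mul_sum]
    refine Finset.sum_congr rfl fun e _ => ?_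
    unfold pairCount
    by_cases h1 : (x.1 e.1, x.1 e.2) = q
    · rw [← h1]
    · by_cases h2 : (x.1 e.2, x.1 e.1) = q
      · rw [← h2, hpsymm (x.1 e.1)]
      · simp [h1, h2]
  have h2 : condMean p an n x.1 q =
      p q.1 q.2 / an * (L1 n x q.1 * L1 n x q.2) - p q.1 q.2 / an * (d / n ^ 2) := by
    unfold condMean
    rw [h1, hd]
    unfold L1
    field_simp
  have hr0 : 0 ≤ p q.1 q.2 / an := div_nonneg hp0 han.le
  have h3 : |p q.1 q.2 / an * (d / n ^ 2)| ≤ B / n := by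
    rw [abs_of_nonneg (by positivity)]
    have : d / (n:ℝ) ^ 2 ≤ 1 / n := by
      rw [div_le_div_iff₀ (by positivity) hn']
      nlinarith
    calc _ ≤ p q.1 q.2 / an * (1 / n) := mul_le_mul_of_nonneg_left this hr0
      _ ≤ B * (1 / n) := mul_le_mul_of_nonneg_right hB (by positivity)
      _ = _ := by ring
  have h4 : |(p q.1 q.2 / an - C q.1 q.2) * (L1 n x q.1 * L1 n x q.2)| ≤
      |p q.1 q.2 / an - C q.1 q.2| := by
    rw [abs_mul]
    apply mul_le_of_le_one_right (abs_nonneg _)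
    rw [abs_of_nonneg (mul_nonneg (L1_nonneg _ _) (L1_nonneg _ _))]
    exact mul_le_one₀ (L1_le_one _ _) (L1_nonneg _ _) (L1_le_one _ _)
  calc _ = |(p q.1 q.2 / an - C q.1 q.2) * (L1 n x q.1 * L1 n x q.2) -
        p q.1 q.2 / an * (d / n ^ 2)| := by rw [h2]; congr 1; ring
    _ ≤ _ := abs_sub _ _
    _ ≤ _ := add_le_add h4 h3

lemma one_le_exp_add_exp {y t δ : ℝ} (ht : 0 ≤ t) (h : δ ≤ |y|) :
    1 ≤ Real.exp (t * y - t * δ) + Real.exp (-t * y - t * δ) := by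
  rcases le_abs.1 h with h | h
  · have : 1 ≤ Real.exp (t * y - t * δ) := Real.one_le_exp (by nlinarith)
    linarith [Real.exp_pos (-t * y - t * δ)]
  · have : 1 ≤ Real.exp (-t * y - t * δ) := Real.one_le_exp (by nlinarith)
    linarith [Real.exp_pos (t * y - t * δ)]

variable [Fintype 𝒳]

lemma sum_graphWeight_mul_exp_le {ν : 𝒳 → ℝ} {p : 𝒳 → 𝒳 → ℝ} (hν : ∀ a, 0 ≤ ν a)
    (hνs : ∑ c, ν c = 1) (hp0 : ∀ a b, 0 ≤ p a b) (hp1 : ∀ a b, p a b ≤ 1) {n : ℕ} (hn : 0 < n)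
    {an B : ℝ} (han : 0 < an) (hB : ∀ a b, p a b ≤ an * B) (q : 𝒳 × 𝒳) {t : ℝ}
    (ht : |t| ≤ 1 / 2) :
    ∑ x, graphWeight ν p n x *
      Real.exp (t * ((L2 an n x q - condMean p an n x.1 q) * ((n:ℝ) ^ 2 * an))) ≤
      Real.exp (4 * t ^ 2 * B * (n ^ 2 * an)) := by
  have hs : (n:ℝ) ^ 2 * an ≠ 0 := by positivity
  rw [sum_graphWeight_mul]
  calc _ ≤ ∑ f : Fin n → 𝒳, (∏ v, ν (f v)) * Real.exp (4 * t ^ 2 * B * (n ^ 2 * an)) := by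
        refine Finset.sum_le_sum fun f _ =>
          mul_le_mul_of_nonneg_left ?_ (Finset.prod_nonneg fun v _ => hν _)
        have key := sum_powerset_bernoulli_exp_le (Edges n) (fun e => p (f e.1) (f e.2))
          (pairCount f q) (fun e => hp0 _ _) (fun e => hp1 _ _) t (fun e => by
            rw [abs_mul, abs_of_nonneg (pairCount_nonneg f q e)]
            nlinarith [pairCount_nonneg f q e, pairCount_le f q e, abs_nonneg t])
        refine le_trans (le_of_eq ?_) (key.trans (Real.exp_le_exp.2 ?_))
        · refine Finset.sum_congr rfl fun E _ => ?_
          congr 3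
          unfold L2 condMean
          rw [sub_mul, div_mul_cancel₀ _ hs, div_mul_cancel₀ _ hs]
          rfl
        · have hb : ∑ e ∈ Edges n, p (f e.1) (f e.2) * pairCount f q e ^ 2 ≤
              ∑ e ∈ Edges n, 4 * (an * B) := by
            refine Finset.sum_le_sum fun e _ => ?_
            have : pairCount f q e ^ 2 ≤ 4 := by
              nlinarith [pairCount_nonneg f q e, pairCount_le f q e]
            nlinarith [hB (f e.1) (f e.2), hp0 (f e.1) (f e.2)]
          have hc : ((Edges n).card : ℝ) ≤ n ^ 2 := by
            have := Finset.card_le_univ (Edges n)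
            rw [Fintype.card_prod, Fintype.card_fin] at this
            rw [sq]
            exact_mod_cast this
          have hB0 : 0 ≤ an * B := (hp0 q.1 q.2).trans (hB q.1 q.2)
          rw [Finset.sum_const, nsmul_eq_mul] at hb
          calc _ ≤ t ^ 2 * ((n:ℝ) ^ 2 * (4 * (an * B))) := by
                refine mul_le_mul_of_nonneg_left (hb.trans ?_) (sq_nonneg t)
                exact mul_le_mul_of_nonneg_right hc (by linarith)
            _ = _ := by ring
    _ = _ := by rw [← Finset.sum_mul, sum_prod_colour, hνs, one_pow, one_mul]

lemma graphPr_L2_dev_le {ν : 𝒳 → ℝ} {p : 𝒳 → 𝒳 → ℝ} (hν : ∀ a, 0 ≤ ν a)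
    (hνs : ∑ c, ν c = 1) (hp0 : ∀ a b, 0 ≤ p a b) (hp1 : ∀ a b, p a b ≤ 1) {n : ℕ} (hn : 0 < n)
    {an B : ℝ} (han : 0 < an) (hB : ∀ a b, p a b ≤ an * B) (q : 𝒳 × 𝒳) {t δ : ℝ}
    (ht0 : 0 ≤ t) (ht : t ≤ 1 / 2) :
    graphPr ν p n {x | δ ≤ |L2 an n x q - condMean p an n x.1 q|} ≤
      2 * Real.exp ((4 * t ^ 2 * B - t * δ) * (n ^ 2 * an)) := by
  have hs : 0 < (n:ℝ) ^ 2 * an := by positivity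
  let y : (Fin n → 𝒳) × Finset (Fin n × Fin n) → ℝ := fun x =>
    (L2 an n x q - condMean p an n x.1 q) * ((n:ℝ) ^ 2 * an)
  refine (graphPr_le_sum hν hp0 hp1
    (G := fun x => Real.exp (t * y x - t * (δ * ((n:ℝ) ^ 2 * an))) +
      Real.exp (-t * y x - t * (δ * ((n:ℝ) ^ 2 * an)))) (fun x => by positivity) ?_).trans ?_
  · intro x hx
    apply one_le_exp_add_exp ht0
    simp only [y]
    rw [abs_mul, abs_of_pos hs]
    exact mul_le_mul_of_nonneg_right hx hs.le
  · have h1 := sum_graphWeight_mul_exp_le hν hνs hp0 hp1 hn han hB q (t := t)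
      (by rwa [abs_of_nonneg ht0])
    have h2 := sum_graphWeight_mul_exp_le hν hνs hp0 hp1 hn han hB q (t := -t)
      (by rwa [abs_neg, abs_of_nonneg ht0])
    simp only [sub_eq_add_neg, Real.exp_add, mul_add, Finset.sum_add_distrib, ← mul_assoc,
      ← Finset.sum_mul]
    simp only [sub_eq_add_neg] at h1 h2
    rw [← add_mul]
    have h3 : (4 * t ^ 2 * B + -(t * δ)) * (n ^ 2 * an) =
      4 * t ^ 2 * B * (n ^ 2 * an) + -(t * δ * n ^ 2 * an) := by ring
    simp only [← mul_assoc] at h1 h2 h3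
    rw [h3, Real.exp_add, ← mul_assoc]
    refine mul_le_mul_of_nonneg_right ?_ (Real.exp_pos _).le
    simp only [y, ← mul_assoc, sub_eq_add_neg]
    rw [neg_sq] at h2
    linarith

/-- `L2` is exponentially close to `C L1 ⊗ L1` at speed `n² aₙ`, uniformly in the colour law. -/
lemma exists_graphPr_L2_dev_le {p : ℕ → 𝒳 → 𝒳 → ℝ} (hp0 : ∀ n a b, 0 ≤ p n a b)
    (hp1 : ∀ n a b, p n a b ≤ 1) (hpsymm : ∀ n a b, p n a b = p n b a)
    {C : 𝒳 → 𝒳 → ℝ} {a : ℕ → ℝ} (hapos : ∀ n, 0 < a n)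
    (hconv : ∀ i j, Filter.Tendsto (fun n => p n i j / a n) Filter.atTop (nhds (C i j)))
    {δ : ℝ} (hδ : 0 < δ) :
    ∃ c : ℝ, 0 < c ∧ ∀ᶠ n : ℕ in atTop, ∀ ν : 𝒳 → ℝ, (∀ i, 0 ≤ ν i) → ∑ i, ν i = 1 →
      graphPr ν (p n) n {x | ∃ q : 𝒳 × 𝒳,
        δ < |L2 (a n) n x q - C q.1 q.2 * L1 n x q.1 * L1 n x q.2|} ≤
      Fintype.card (𝒳 × 𝒳) * (2 * Real.exp (-c * (n ^ 2 * a n))) := by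
  obtain ⟨B, hB1, hB⟩ : ∃ B : ℝ, 1 ≤ B ∧ ∀ q : 𝒳 × 𝒳, C q.1 q.2 + 1 ≤ B := by
    obtain ⟨M, hM⟩ := Finite.exists_le (fun q : 𝒳 × 𝒳 => C q.1 q.2 + 1)
    exact ⟨max 1 M, le_max_left _ _, fun q => (hM q).trans (le_max_right _ _)⟩
  set t : ℝ := min (1 / 2) (δ / (16 * B)) with ht
  have ht0 : 0 < t := by positivity
  have htB : 16 * B * t ≤ δ := by
    have : t ≤ δ / (16 * B) := min_le_right _ _
    rwa [le_div_iff₀ (by positivity), mul_comm] at this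
  refine ⟨t * δ / 4, by positivity, ?_⟩
  have hclose : ∀ᶠ n : ℕ in atTop, ∀ q : 𝒳 × 𝒳,
      |p n q.1 q.2 / a n - C q.1 q.2| < min 1 (δ / 4) := by
    rw [Filter.eventually_all]
    intro q
    have := (Metric.tendsto_nhds.1 (hconv q.1 q.2)) (min 1 (δ / 4)) (by positivity)
    simpa only [Real.dist_eq] using this
  have hsmall : ∀ᶠ n : ℕ in atTop, B / n < δ / 4 :=
    (tendsto_const_div_atTop_nhds_zero_nat B).eventually_lt_const (by positivity)
  filter_upwards [hclose, hsmall, eventually_gt_atTop 0] with n h1 h2 hn ν hν hνs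
  have hr : ∀ q : 𝒳 × 𝒳, p n q.1 q.2 / a n ≤ B := fun q => by
    have := (abs_lt.1 ((h1 q).trans_le (min_le_left _ _))).2
    linarith [hB q]
  have hpB : ∀ i j, p n i j ≤ a n * B := fun i j => by
    have := hr (i, j)
    rwa [div_le_iff₀ (hapos n), mul_comm] at this
  refine (graphPr_le_sum_graphPr hν (hp0 n) (hp1 n)
    (fun q => {x | δ / 2 ≤ |L2 (a n) n x q - condMean (p n) (a n) n x.1 q|}) ?_).trans ?_
  · rintro x ⟨q, hq⟩
    refine ⟨q, ?_⟩
    have h3 := abs_condMean_sub_le (C := C) (hpsymm n) (hapos n) hn q (hp0 n _ _) (hr q) x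
    have h4 := abs_sub_le (L2 (a n) n x q) (condMean (p n) (a n) n x.1 q)
      (C q.1 q.2 * L1 n x q.1 * L1 n x q.2)
    have h5 := (h1 q).trans_le (min_le_right _ _)
    simp only [Set.mem_ofPred_eq]
    linarith
  · calc _ ≤ ∑ q : 𝒳 × 𝒳, 2 * Real.exp (-(t * δ / 4) * (n ^ 2 * a n)) := by
          refine Finset.sum_le_sum fun q _ => ?_
          refine (graphPr_L2_dev_le hν hνs (hp0 n) (hp1 n) hn (hapos n) hpB q ht0.le
            (min_le_left _ _)).trans ?_
          have := hapos n
          gcongr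
          nlinarith
      _ = _ := by rw [Finset.sum_const, nsmul_eq_mul, Finset.card_univ]

end CRG
namespace CRG

variable {𝒳 : Type}

/-- The map `ω ↦ Cω⊗ω`. -/
def tensor (C : 𝒳 → 𝒳 → ℝ) (ω : 𝒳 → ℝ) : 𝒳 × 𝒳 → ℝ :=
  fun q => C q.1 q.2 * ω q.1 * ω q.2

lemma continuous_tensor (C : 𝒳 → 𝒳 → ℝ) : Continuous (tensor C) := by
  unfold tensor
  fun_prop

variable [Fintype 𝒳]

/-! ### Relative entropy -/

/-- Real-valued relative entropy with respect to a strictly positive vector. -/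
def entropy (μ ν : 𝒳 → ℝ) : ℝ := ∑ c, ν c * Real.log (ν c / μ c)

lemma relEnt_eq {μ : 𝒳 → ℝ} (hμ0 : ∀ c, 0 < μ c) (ν : 𝒳 → ℝ) :
    relEnt ν μ = ENNReal.ofReal (entropy μ ν) := by
  unfold relEnt
  rw [if_pos fun c hc => absurd hc (hμ0 c).ne']
  rfl

lemma continuous_entropy {μ : 𝒳 → ℝ} (hμ0 : ∀ c, 0 < μ c) : Continuous (entropy μ) := by
  have : entropy μ = fun ν => ∑ c, (ν c * Real.log (ν c) - ν c * Real.log (μ c)) := by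
    funext ν
    refine Finset.sum_congr rfl fun c _ => ?_
    by_cases h : ν c = 0
    · simp [h]
    · rw [Real.log_div h (hμ0 c).ne', mul_sub]
  rw [this]
  refine continuous_finsetSum _ fun c _ => ?_
  exact (Real.continuous_mul_log.comp (continuous_apply c)).sub
    ((continuous_apply c).mul continuous_const)

lemma entropy_nonneg {μ ν : 𝒳 → ℝ} (hμ0 : ∀ c, 0 < μ c) (hν : ∀ c, 0 ≤ ν c)
    (h : ∑ c, μ c = ∑ c, ν c) : 0 ≤ entropy μ ν := by
  have : ∑ c, (ν c - μ c) ≤ entropy μ ν := by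
    refine Finset.sum_le_sum fun c _ => ?_
    rcases (hν c).eq_or_lt with h0 | h0
    · simp [← h0, (hμ0 c).le]
    · have h1 := Real.log_le_sub_one_of_pos (div_pos (hμ0 c) h0)
      have h2 : Real.log (ν c / μ c) = - Real.log (μ c / ν c) := by
        rw [← Real.log_inv, inv_div]
      rw [h2]
      have h3 := mul_le_mul_of_nonneg_left h1 h0.le
      rw [mul_sub, mul_div_cancel₀ _ h0.ne'] at h3
      linarith
  rwa [Finset.sum_sub_distrib, h, sub_self] at this

lemma I2_of_eq {μ : 𝒳 → ℝ} (hμ0 : ∀ c, 0 < μ c) {C : 𝒳 → 𝒳 → ℝ}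
    {z : (𝒳 → ℝ) × (𝒳 × 𝒳 → ℝ)} (hz : z.2 = tensor C z.1) :
    I2 μ C z = ENNReal.ofReal (entropy μ z.1) := by
  unfold I2
  rw [if_pos (by exact hz), relEnt_eq hμ0]

lemma I2_of_ne {μ : 𝒳 → ℝ} {C : 𝒳 → 𝒳 → ℝ}
    {z : (𝒳 → ℝ) × (𝒳 × 𝒳 → ℝ)} (hz : z.2 ≠ tensor C z.1) : I2 μ C z = ⊤ := by
  unfold I2
  rw [if_neg (by exact hz)]

lemma lowerSemicontinuous_I2 {μ : 𝒳 → ℝ} (hμ0 : ∀ c, 0 < μ c) (C : 𝒳 → 𝒳 → ℝ) :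
    LowerSemicontinuous (I2 μ C) := by
  intro z y hy
  by_cases hz : z.2 = tensor C z.1
  · rw [I2_of_eq hμ0 hz] at hy
    have hc : Continuous fun z : (𝒳 → ℝ) × (𝒳 × 𝒳 → ℝ) => ENNReal.ofReal (entropy μ z.1) :=
      ENNReal.continuous_ofReal.comp ((continuous_entropy hμ0).comp continuous_fst)
    filter_upwards [hc.continuousAt.eventually_const_lt hy] with z' hz'
    by_cases h : z'.2 = tensor C z'.1
    · rwa [I2_of_eq hμ0 h]
    · rw [I2_of_ne h]
      exact hz'.trans_le le_top
  · have ho : IsOpen {z : (𝒳 → ℝ) × (𝒳 × 𝒳 → ℝ) | z.2 ≠ tensor C z.1} :=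
      isOpen_ne_fun continuous_snd ((continuous_tensor C).comp continuous_fst)
    filter_upwards [ho.mem_nhds hz] with z' hz'
    rw [I2_of_ne hz']
    rw [I2_of_ne hz] at hy
    exact hy

lemma isClosed_MSpace : IsClosed (MSpace 𝒳) := by
  unfold MSpace
  simp only [Set.ofPred_and, Set.ofPred_forall]
  refine IsClosed.inter (isClosed_iInter fun c => isClosed_le ?_ ?_) (IsClosed.inter
    (isClosed_eq ?_ ?_) (IsClosed.inter (isClosed_iInter fun c => isClosed_le ?_ ?_)
    (isClosed_iInter fun c => isClosed_iInter fun d => isClosed_eq ?_ ?_))) <;> fun_prop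

lemma isCompact_sublevel_I2 {μ : 𝒳 → ℝ} (hμ0 : ∀ c, 0 < μ c) (C : 𝒳 → 𝒳 → ℝ) (c : ℝ) :
    IsCompact {z | z ∈ MSpace 𝒳 ∧ I2 μ C z ≤ ENNReal.ofReal c} := by
  classical
  have hK : IsCompact ((fun ω => (ω, tensor C ω)) '' stdSimplex ℝ 𝒳) :=
    (isCompact_stdSimplex ℝ 𝒳).image (continuous_id.prodMk (continuous_tensor C))
  refine hK.of_isClosed_subset
    (isClosed_MSpace.inter ((lowerSemicontinuous_I2 hμ0 C).isClosed_preimage _)) ?_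
  rintro z ⟨hz, hc⟩
  have h : z.2 = tensor C z.1 := by
    by_contra h
    rw [I2_of_ne h] at hc
    exact absurd hc (by simp)
  exact ⟨z.1, ⟨hz.1, hz.2.1⟩, Prod.ext rfl h.symm⟩

/-! ### Empirical colour measure -/

lemma sum_colour [DecidableEq 𝒳] {n : ℕ} (hn : 0 < n)
    (x : (Fin n → 𝒳) × Finset (Fin n × Fin n)) (g : 𝒳 → ℝ) :
    ∑ v, g (x.1 v) = n * ∑ c, L1 n x c * g c := by
  have hn' : (n:ℝ) ≠ 0 := by exact_mod_cast hn.ne'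
  rw [← Finset.sum_fiberwise_of_maps_to (s := Finset.univ) (t := Finset.univ) (g := x.1)
    (fun v _ => Finset.mem_univ (x.1 v)), Finset.mul_sum]
  refine Finset.sum_congr rfl fun c _ => ?_
  rw [Finset.sum_congr rfl (g := fun _ => g c)
      (fun v hv => congrArg g (Finset.mem_filter.1 hv).2),
    Finset.sum_const, nsmul_eq_mul]
  unfold L1
  field_simp

lemma sum_L1 [DecidableEq 𝒳] {n : ℕ} (hn : 0 < n)
    (x : (Fin n → 𝒳) × Finset (Fin n × Fin n)) : ∑ c, L1 n x c = 1 := by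
  have hn' : (n:ℝ) ≠ 0 := by exact_mod_cast hn.ne'
  have := sum_colour hn x (fun _ => 1)
  simp only [Finset.sum_const, Finset.card_univ, Fintype.card_fin, nsmul_eq_mul, mul_one] at this
  exact mul_left_cancel₀ hn' (by rw [← this, mul_one])

lemma L1_L2_mem_MSpace [DecidableEq 𝒳] {n : ℕ} (hn : 0 < n) {an : ℝ} (han : 0 < an)
    (x : (Fin n → 𝒳) × Finset (Fin n × Fin n)) : (L1 n x, L2 an n x) ∈ MSpace 𝒳 := by
  refine ⟨L1_nonneg x, sum_L1 hn x, fun q => ?_, fun i j => ?_⟩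
  · unfold L2
    exact div_nonneg (Finset.sum_nonneg fun e _ => pairCount_nonneg x.1 q e) (by positivity)
  · change L2 an n x (i, j) = L2 an n x (j, i)
    unfold L2
    refine congrArg (· / ((n:ℝ) ^ 2 * an)) (Finset.sum_congr rfl fun e _ => ?_)
    rw [add_comm]
    simp only [Prod.mk.injEq, and_comm]

/-- Change of colour law. -/
lemma prod_colour_eq [DecidableEq 𝒳] {n : ℕ} (hn : 0 < n)
    (x : (Fin n → 𝒳) × Finset (Fin n × Fin n)) {μ ν : 𝒳 → ℝ} (hμ0 : ∀ c, 0 < μ c)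
    (hν : ∀ v, 0 < ν (x.1 v)) :
    ∏ v, μ (x.1 v) =
      Real.exp (-(n * ∑ c, L1 n x c * Real.log (ν c / μ c))) * ∏ v, ν (x.1 v) := by
  rw [← sum_colour hn x (fun c => Real.log (ν c / μ c)), ← Finset.sum_neg_distrib, Real.exp_sum,
    ← Finset.prod_mul_distrib]
  refine Finset.prod_congr rfl fun v _ => ?_
  rw [Real.exp_neg, Real.exp_log (div_pos (hν v) (hμ0 _)), inv_div,
    div_mul_cancel₀ _ (hν v).ne']

/-- The total likelihood of colourings under their own empirical laws is at most the number
of types. -/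
lemma sum_prod_L1_le [DecidableEq 𝒳] {n : ℕ} (hn : 0 < n) :
    ∑ f : Fin n → 𝒳, ∏ v, L1 n (f, ∅) (f v) ≤ ((n:ℝ) + 1) ^ Fintype.card 𝒳 := by
  let τ : (Fin n → 𝒳) → 𝒳 → Fin (n + 1) := fun f c =>
    ⟨(Finset.univ.filter (fun v : Fin n => f v = c)).card, by
      have := Finset.card_le_univ (Finset.univ.filter (fun v : Fin n => f v = c))
      rw [Fintype.card_fin] at this
      omega⟩
  rw [← Finset.sum_fiberwise_of_maps_to (fun f _ => Finset.mem_univ (τ f))]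
  calc _ ≤ ∑ k : 𝒳 → Fin (n + 1), (1:ℝ) := by
        refine Finset.sum_le_sum fun k _ => ?_
        by_cases hk : ∃ f, τ f = k
        · obtain ⟨f, rfl⟩ := hk
          calc _ ≤ ∑ f' : Fin n → 𝒳, ∏ v, L1 n (f, ∅) (f' v) := by
                rw [Finset.sum_congr rfl (g := fun f' => ∏ v, L1 n (f, ∅) (f' v))]
                · exact Finset.sum_le_univ_sum_of_nonneg
                    fun f' => Finset.prod_nonneg fun v _ => L1_nonneg _ _
                · intro f' hf'
                  have h := (Finset.mem_filter.1 hf').2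
                  refine Finset.prod_congr rfl fun v _ => ?_
                  have := congrArg Fin.val (congrFun h (f' v))
                  simp only [τ] at this
                  unfold L1
                  simp only [this]
            _ = 1 := by rw [sum_prod_colour, sum_L1 hn, one_pow]
        · rw [Finset.filter_eq_empty_iff.2 fun f _ h => hk ⟨f, h⟩]
          simp
    _ = _ := by simp

/-- Sanov's upper bound for superlevel sets of the relative entropy. -/
lemma graphPr_entropy_gt_le [DecidableEq 𝒳] {μ : 𝒳 → ℝ} {p : 𝒳 → 𝒳 → ℝ}
    (hμ0 : ∀ c, 0 < μ c) {n : ℕ} (hn : 0 < n) (α : ℝ) :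
    graphPr μ p n {x | α < entropy μ (L1 n x)} ≤
      Real.exp (-(n * α)) * ((n:ℝ) + 1) ^ Fintype.card 𝒳 := by
  classical
  rw [graphPr_eq]
  have := sum_graphWeight_mul_colour μ p n
    (fun f => if α < entropy μ (L1 n (f, ∅)) then 1 else 0)
  have h2 : ∀ x : (Fin n → 𝒳) × Finset (Fin n × Fin n),
      Set.indicator {x | α < entropy μ (L1 n x)}
        (1 : (Fin n → 𝒳) × Finset (Fin n × Fin n) → ℝ) x =
      if α < entropy μ (L1 n (x.1, ∅)) then 1 else 0 := by
    intro x
    rw [Set.indicator_apply]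
    rfl
  simp_rw [h2]
  rw [this]
  refine le_trans (Finset.sum_le_sum fun f _ => ?_)
    ((Finset.mul_sum _ _ _).symm.trans_le
      (mul_le_mul_of_nonneg_left (sum_prod_L1_le (𝒳 := 𝒳) hn) (Real.exp_pos (-(n * α))).le))
  split_ifs with h
  · rw [mul_one, prod_colour_eq hn (f, ∅) hμ0 (L1_colour_pos (f, ∅))]
    refine mul_le_mul_of_nonneg_right (Real.exp_le_exp.2 ?_)
      (Finset.prod_nonneg fun v _ => L1_nonneg _ _)
    exact neg_le_neg (mul_le_mul_of_nonneg_left h.le (Nat.cast_nonneg n))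
  · rw [mul_zero]
    exact mul_nonneg (Real.exp_pos _).le (Finset.prod_nonneg fun v _ => L1_nonneg _ _)

lemma sum_colour_exp_le [DecidableEq 𝒳] {ν : 𝒳 → ℝ} (p : 𝒳 → 𝒳 → ℝ) (hν : ∀ c, 0 ≤ ν c)
    (hνs : ∑ c, ν c = 1) {n : ℕ} (hn : 0 < n) (c : 𝒳) {t : ℝ} (ht : |t| ≤ 1) :
    ∑ x, graphWeight ν p n x * Real.exp (t * (n * (L1 n x c - ν c))) ≤
      Real.exp (n * t ^ 2) := by
  have h1 := sum_graphWeight_mul_colour ν p n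
    (fun f => Real.exp (t * (n * (L1 n (f, ∅) c - ν c))))
  refine (h1.trans_le ?_)
  let Y : 𝒳 → ℝ := fun d => (if d = c then 1 else 0) - ν c
  have hν1 : ν c ≤ 1 := by
    rw [← hνs]
    exact Finset.single_le_sum (fun d _ => hν d) (Finset.mem_univ c)
  have hY : ∀ d, |Y d| ≤ 1 := fun d => by
    simp only [Y]
    rw [abs_le]
    have := hν c
    split_ifs <;> constructor <;> linarith
  have h2 : ∀ f : Fin n → 𝒳, (∏ v, ν (f v)) * Real.exp (t * (n * (L1 n (f, ∅) c - ν c))) =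
      ∏ v, ν (f v) * Real.exp (t * Y (f v)) := by
    intro f
    rw [Finset.prod_mul_distrib, ← Real.exp_sum, ← Finset.mul_sum,
      sum_colour hn (f, ∅) Y]
    simp only [Y, mul_sub, Finset.sum_sub_distrib, ← Finset.sum_mul, sum_L1 hn]
    simp
  simp_rw [h2]
  rw [sum_prod_colour n (fun d => ν d * Real.exp (t * Y d)), Real.exp_nat_mul]
  refine pow_le_pow_left₀ (Finset.sum_nonneg fun d _ => mul_nonneg (hν d) (Real.exp_pos _).le) ?_ n
  calc _ ≤ ∑ d, (ν d * (1 + t ^ 2) + t * (ν d * Y d)) := by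
        refine Finset.sum_le_sum fun d _ => ?_
        have h3 : |t * Y d| ≤ 1 := by
          rw [abs_mul]
          exact mul_le_one₀ ht (abs_nonneg _) (hY d)
        have h4 := mul_le_mul_of_nonneg_left (exp_le_one_add_add_sq h3) (hν d)
        have h5 : Y d ^ 2 ≤ 1 := (sq_le_one_iff_abs_le_one _).2 (hY d)
        have h6 := mul_le_mul_of_nonneg_left h5 (mul_nonneg (hν d) (sq_nonneg t))
        nlinarith
    _ = 1 + t ^ 2 := by
        rw [Finset.sum_add_distrib, ← Finset.sum_mul, ← Finset.mul_sum, hνs]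
        have : ∑ d, ν d * Y d = 0 := by
          simp only [Y, mul_sub, Finset.sum_sub_distrib, ← Finset.sum_mul, hνs]
          simp
        rw [this]
        ring
    _ ≤ _ := by linarith [Real.add_one_le_exp (t ^ 2)]

/-- Law of large numbers for `L1`, with an exponential bound. -/
lemma graphPr_L1_dev_le [DecidableEq 𝒳] {ν : 𝒳 → ℝ} {p : 𝒳 → 𝒳 → ℝ} (hν : ∀ c, 0 ≤ ν c)
    (hνs : ∑ c, ν c = 1) (hp0 : ∀ a b, 0 ≤ p a b) (hp1 : ∀ a b, p a b ≤ 1) {n : ℕ} (hn : 0 < n)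
    {δ : ℝ} (hδ0 : 0 ≤ δ) (hδ1 : δ ≤ 1) :
    graphPr ν p n {x | ∃ c, δ ≤ |L1 n x c - ν c|} ≤
      Fintype.card 𝒳 * (2 * Real.exp (-(δ ^ 2 / 4) * n)) := by
  have hn' : (0:ℝ) < n := by exact_mod_cast hn
  refine (graphPr_le_sum_graphPr hν hp0 hp1 (fun c => {x | δ ≤ |L1 n x c - ν c|})
    (fun x hx => hx)).trans ?_
  calc _ ≤ ∑ c : 𝒳, 2 * Real.exp (-(δ ^ 2 / 4) * n) := by
        refine Finset.sum_le_sum fun c _ => ?_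
        refine (graphPr_le_sum hν hp0 hp1
          (G := fun x => Real.exp ((δ / 2) * (n * (L1 n x c - ν c)) - (δ / 2) * (n * δ)) +
            Real.exp (-(δ / 2) * (n * (L1 n x c - ν c)) - (δ / 2) * (n * δ)))
          (fun x => by positivity) ?_).trans ?_
        · intro x hx
          apply one_le_exp_add_exp (by positivity)
          rw [abs_mul, abs_of_pos hn']
          exact mul_le_mul_of_nonneg_left hx hn'.le
        · have h1 := sum_colour_exp_le p hν hνs hn c (t := δ / 2)
            (by rw [abs_of_nonneg (by positivity)]; linarith)
          have h2 := sum_colour_exp_le p hν hνs hn c (t := -(δ / 2))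
            (by rw [abs_neg, abs_of_nonneg (by positivity)]; linarith)
          rw [neg_sq] at h2
          have h3 : -(δ ^ 2 / 4) * (n:ℝ) = n * (δ / 2) ^ 2 + -((δ / 2) * (n * δ)) := by ring
          rw [h3, Real.exp_add, ← mul_assoc 2]
          have h4 : ∀ w x y z : ℝ, w * (Real.exp (x - z) + Real.exp (y - z)) =
              (w * Real.exp x + w * Real.exp y) * Real.exp (-z) := fun w x y z => by
            rw [sub_eq_add_neg, sub_eq_add_neg, Real.exp_add, Real.exp_add]
            ring
          simp_rw [h4]
          rw [← Finset.sum_mul, Finset.sum_add_distrib]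
          refine mul_le_mul_of_nonneg_right ?_ (Real.exp_pos _).le
          linarith
    _ = _ := by rw [Finset.sum_const, nsmul_eq_mul, Finset.card_univ]

end CRG
namespace CRG

/-! ### Normalised extended logarithms -/

lemma inv_mul_elog_le {n : ℕ} (hn : 0 < n) {P α : ℝ} (h : P ≤ Real.exp (-(n * α))) :
    ((1 / (n:ℝ) : ℝ) : EReal) * elog P ≤ ((-α : ℝ) : EReal) := by
  have hn' : (0:ℝ) < n := by exact_mod_cast hn
  unfold elog
  split_ifs with hP
  · rw [EReal.coe_mul_bot_of_pos (by positivity)]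
    exact bot_le
  · rw [← EReal.coe_mul, EReal.coe_le_coe_iff]
    have h1 := Real.log_le_log (not_le.1 hP) h
    rw [Real.log_exp] at h1
    rw [one_div, inv_mul_le_iff₀ hn']
    linarith

lemma le_inv_mul_elog {n : ℕ} (hn : 0 < n) {P α : ℝ} (h : Real.exp (-(n * α)) ≤ P) :
    ((-α : ℝ) : EReal) ≤ ((1 / (n:ℝ) : ℝ) : EReal) * elog P := by
  have hn' : (0:ℝ) < n := by exact_mod_cast hn
  have hP := (Real.exp_pos _).trans_le h
  unfold elog
  rw [if_neg (not_le.2 hP), ← EReal.coe_mul, EReal.coe_le_coe_iff]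
  have h1 := Real.log_le_log (Real.exp_pos _) h
  rw [Real.log_exp] at h1
  rw [one_div, le_inv_mul_iff₀ hn']
  linarith

/-- Exponential decay beats polynomial growth. -/
lemma eventually_mul_pow_mul_exp_le (D : ℝ) (k : ℕ) {c : ℝ} (hc : 0 < c) :
    ∀ᶠ n : ℕ in atTop, D * ((n:ℝ) + 1) ^ k * Real.exp (-(c * n)) ≤ 1 := by
  have h1 : Tendsto (fun x : ℝ => x ^ k * Real.exp (-c * x)) atTop (nhds 0) := by
    have := Real.tendsto_pow_mul_exp_neg_atTop_nhds_zero k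
    have h2 := this.comp (tendsto_id.const_mul_atTop hc)
    have h3 := h2.const_mul ((c ^ k)⁻¹)
    rw [mul_zero] at h3
    refine h3.congr fun x => ?_
    simp only [Function.comp, id, mul_pow, neg_mul]
    field_simp
  have h2 : Tendsto (fun n : ℕ => (n:ℝ) + 1) atTop atTop :=
    tendsto_atTop_add_const_right _ _ tendsto_natCast_atTop_atTop
  have h3 := (h1.comp h2).const_mul (D * Real.exp c)
  rw [mul_zero] at h3
  filter_upwards [h3.eventually_le_const one_pos] with n hn
  refine le_trans (le_of_eq ?_) hn
  simp only [Function.comp]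
  have : -(c * (n:ℝ)) = c + -c * (n + 1) := by ring
  rw [this, Real.exp_add]
  ring

variable {𝒳 : Type} [Fintype 𝒳]

/-- Near the graph of the limit map, a closed set only sees colour laws whose entropy is close
to the infimum of the rate function. -/
lemma exists_forall_entropy_lt {μ : 𝒳 → ℝ} (hμ0 : ∀ c, 0 < μ c) (hμs : ∑ c, μ c = 1)
    (C : 𝒳 → 𝒳 → ℝ) {F : Set ((𝒳 → ℝ) × (𝒳 × 𝒳 → ℝ))} (hFM : F ⊆ MSpace 𝒳)
    (hF : IsClosed F) {α : ℝ} (hα : ∀ z ∈ F, (α : EReal) < (I2 μ C z : EReal)) :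
    ∃ δ : ℝ, 0 < δ ∧ ∀ z ∈ F, (∀ q, |z.2 q - tensor C z.1 q| ≤ δ) → α < entropy μ z.1 := by
  classical
  let g : (𝒳 → ℝ) × (𝒳 × 𝒳 → ℝ) → ℝ := fun z => ‖z.2 - tensor C z.1‖
  have hg : Continuous g :=
    (continuous_snd.sub ((continuous_tensor C).comp continuous_fst)).norm
  let S : Set ((𝒳 → ℝ) × (𝒳 × 𝒳 → ℝ)) := F ∩ ({z | entropy μ z.1 ≤ α} ∩ {z | g z ≤ 1})
  have hSclosed : IsClosed S := hF.inter
    ((isClosed_le ((continuous_entropy hμ0).comp continuous_fst) continuous_const).inter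
      (isClosed_le hg continuous_const))
  have hK : IsCompact ((fun y : (𝒳 → ℝ) × (𝒳 × 𝒳 → ℝ) => (y.1, y.2 + tensor C y.1)) ''
      (stdSimplex ℝ 𝒳 ×ˢ Metric.closedBall 0 1)) :=
    ((isCompact_stdSimplex ℝ 𝒳).prod (isCompact_closedBall 0 1)).image
      (continuous_fst.prodMk
        (continuous_snd.add ((continuous_tensor C).comp continuous_fst)))
  have hS : IsCompact S := by
    refine hK.of_isClosed_subset hSclosed ?_
    rintro z ⟨hz, -, hz1⟩
    refine ⟨(z.1, z.2 - tensor C z.1), ⟨⟨(hFM hz).1, (hFM hz).2.1⟩, ?_⟩, ?_⟩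
    · rw [mem_closedBall_zero_iff]
      exact hz1
    · simp
  have hpos : ∀ z ∈ S, 0 < g z := by
    rintro z ⟨hz, hz1, -⟩
    refine lt_of_le_of_ne (norm_nonneg _) fun h => ?_
    have heq : z.2 = tensor C z.1 := sub_eq_zero.1 (norm_eq_zero.1 h.symm)
    have h2 := hα z hz
    rw [I2_of_eq hμ0 heq, EReal.coe_ennreal_ofReal, max_eq_left, EReal.coe_lt_coe_iff] at h2
    · exact absurd hz1 (not_le.2 h2)
    · exact entropy_nonneg hμ0 (hFM hz).1 (hμs.trans (hFM hz).2.1.symm)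
  obtain ⟨δ, hδ, hδS⟩ : ∃ δ : ℝ, 0 < δ ∧ ∀ z ∈ S, δ < g z := by
    rcases S.eq_empty_or_nonempty with h | h
    · exact ⟨1, one_pos, by simp [h]⟩
    · obtain ⟨z, hz, hmin⟩ := hS.exists_isMinOn h hg.continuousOn
      exact ⟨g z / 2, half_pos (hpos z hz), fun y hy =>
        (half_lt_self (hpos z hz)).trans_le (hmin hy)⟩
  refine ⟨min δ 1, by positivity, fun z hz hq => ?_⟩
  by_contra! hcon
  have hgz : g z ≤ min δ 1 := (pi_norm_le_iff_of_nonneg (by positivity)).2 hq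
  exact absurd (hδS z ⟨hz, hcon, hgz.trans (min_le_right _ _)⟩)
    (not_lt.2 (hgz.trans (min_le_left _ _)))

variable [DecidableEq 𝒳]

/-- The exponential upper bound on closed sets. -/
lemma eventually_graphPr_le {μ : 𝒳 → ℝ} (hμ0 : ∀ c, 0 < μ c) (hμs : ∑ c, μ c = 1)
    {p : ℕ → 𝒳 → 𝒳 → ℝ} (hp0 : ∀ n a b, 0 ≤ p n a b)
    (hp1 : ∀ n a b, p n a b ≤ 1) (hpsymm : ∀ n a b, p n a b = p n b a)
    {C : 𝒳 → 𝒳 → ℝ} {a : ℕ → ℝ} (hapos : ∀ n, 0 < a n)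
    (hconv : ∀ i j, Filter.Tendsto (fun n => p n i j / a n) Filter.atTop (nhds (C i j)))
    (hna : Filter.Tendsto (fun n : ℕ => (n : ℝ) * a n) Filter.atTop Filter.atTop)
    {F : Set ((𝒳 → ℝ) × (𝒳 × 𝒳 → ℝ))} (hFM : F ⊆ MSpace 𝒳)
    (hF : IsClosed F) {α β : ℝ} (hβα : β < α)
    (hα : ∀ z ∈ F, (α : EReal) < (I2 μ C z : EReal)) :
    ∀ᶠ n : ℕ in atTop,
      graphPr μ (p n) n {x | (L1 n x, L2 (a n) n x) ∈ F} ≤ Real.exp (-(n * β)) := by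
  obtain ⟨δ, hδ, hδF⟩ := exists_forall_entropy_lt hμ0 hμs C hFM hF hα
  obtain ⟨c, hc, hdev⟩ := exists_graphPr_L2_dev_le hp0 hp1 hpsymm hapos hconv hδ
  set D : ℝ := Fintype.card (𝒳 × 𝒳) * 2 with hD
  have hD0 : 0 ≤ D := by positivity
  filter_upwards [hdev, (hna.const_mul_atTop hc).eventually_ge_atTop α,
    eventually_mul_pow_mul_exp_le (D + 1) (Fintype.card 𝒳) (sub_pos.2 hβα),
    eventually_gt_atTop 0] with n h1 h2 h3 hn
  have hsplit := graphPr_le_add (fun c => (hμ0 c).le) (hp0 n) (hp1 n)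
    (S := {x | (L1 n x, L2 (a n) n x) ∈ F})
    {x | ∃ q : 𝒳 × 𝒳, δ < |L2 (a n) n x q - C q.1 q.2 * L1 n x q.1 * L1 n x q.2|}
    {x | α < entropy μ (L1 n x)} (fun x hx => by
      by_cases h : ∃ q : 𝒳 × 𝒳, δ < |L2 (a n) n x q - C q.1 q.2 * L1 n x q.1 * L1 n x q.2|
      · exact Or.inl h
      · push Not at h
        exact Or.inr (hδF _ hx h))
  have h4 := h1 μ (fun c => (hμ0 c).le) hμs
  have h5 := graphPr_entropy_gt_le (p := p n) hμ0 hn α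
  have h6 : Real.exp (-c * (n ^ 2 * a n)) ≤ Real.exp (-(n * α)) := by
    apply Real.exp_le_exp.2
    have := mul_le_mul_of_nonneg_left h2 (Nat.cast_nonneg (α := ℝ) n)
    linarith
  have h7 : (1:ℝ) ≤ ((n:ℝ) + 1) ^ Fintype.card 𝒳 :=
    one_le_pow₀ (by linarith [Nat.cast_nonneg (α := ℝ) n])
  have h8 : Real.exp (-(n * α)) = Real.exp (-((α - β) * n)) * Real.exp (-(n * β)) := by
    rw [← Real.exp_add]
    congr 1
    ring
  calc _ ≤ D * Real.exp (-(n * α)) + Real.exp (-(n * α)) * ((n:ℝ) + 1) ^ Fintype.card 𝒳 := by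
        have := mul_le_mul_of_nonneg_left h6 hD0
        rw [hD] at this ⊢
        linarith
    _ ≤ (D + 1) * ((n:ℝ) + 1) ^ Fintype.card 𝒳 * Real.exp (-(n * α)) := by
        have := mul_le_mul_of_nonneg_left h7 (mul_nonneg hD0 (Real.exp_pos (-(n * α))).le)
        linarith
    _ = (D + 1) * ((n:ℝ) + 1) ^ Fintype.card 𝒳 * Real.exp (-((α - β) * n)) *
          Real.exp (-(n * β)) := by rw [h8]; ring
    _ ≤ 1 * Real.exp (-(n * β)) := mul_le_mul_of_nonneg_right h3 (Real.exp_pos _).le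
    _ = _ := one_mul _

/-- Change of measure: events on which the log-likelihood ratio is controlled. -/
lemma exp_mul_graphPr_le {μ ν : 𝒳 → ℝ} (hμ0 : ∀ c, 0 < μ c) (hν : ∀ c, 0 ≤ ν c)
    {p : 𝒳 → 𝒳 → ℝ} (hp0 : ∀ a b, 0 ≤ p a b) (hp1 : ∀ a b, p a b ≤ 1) {n : ℕ} (hn : 0 < n)
    {S : Set ((Fin n → 𝒳) × Finset (Fin n × Fin n))} {β : ℝ}
    (hS : ∀ x ∈ S, ∑ c, L1 n x c * Real.log (ν c / μ c) ≤ β) :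
    Real.exp (-(n * β)) * graphPr ν p n S ≤ graphPr μ p n S := by
  classical
  unfold graphPr
  rw [Finset.mul_sum]
  refine Finset.sum_le_sum fun x _ => ?_
  by_cases hx : x ∈ S
  · rw [Set.indicator_of_mem hx, Set.indicator_of_mem hx]
    by_cases hpos : ∀ v, 0 < ν (x.1 v)
    · have h1 := prod_colour_eq hn x hμ0 hpos
      have h2 : Real.exp (-(n * β)) ≤
          Real.exp (-(n * ∑ c, L1 n x c * Real.log (ν c / μ c))) :=
        Real.exp_le_exp.2 (neg_le_neg (mul_le_mul_of_nonneg_left (hS x hx) (Nat.cast_nonneg n)))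
      calc _ ≤ Real.exp (-(n * ∑ c, L1 n x c * Real.log (ν c / μ c))) * graphWeight ν p n x :=
            mul_le_mul_of_nonneg_right h2 (graphWeight_nonneg hν hp0 hp1 n x)
        _ = _ := by
            unfold graphWeight
            rw [h1]
            ring
    · push Not at hpos
      obtain ⟨v, hv⟩ := hpos
      have : ∏ v, ν (x.1 v) = 0 :=
        Finset.prod_eq_zero (Finset.mem_univ v) (le_antisymm hv (hν _))
      have h0 : graphWeight ν p n x = 0 := by
        unfold graphWeight
        rw [this]
        ring
      rw [h0, mul_zero]
      exact graphWeight_nonneg (fun c => (hμ0 c).le) hp0 hp1 n x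
  · rw [Set.indicator_of_notMem hx, Set.indicator_of_notMem hx, mul_zero]

/-- The exponential lower bound on neighbourhoods of points of the graph of the limit map. -/
lemma eventually_le_graphPr {μ : 𝒳 → ℝ} (hμ0 : ∀ c, 0 < μ c)
    {p : ℕ → 𝒳 → 𝒳 → ℝ} (hp0 : ∀ n a b, 0 ≤ p n a b)
    (hp1 : ∀ n a b, p n a b ≤ 1) (hpsymm : ∀ n a b, p n a b = p n b a)
    {C : 𝒳 → 𝒳 → ℝ} {a : ℕ → ℝ} (hapos : ∀ n, 0 < a n)
    (hconv : ∀ i j, Filter.Tendsto (fun n => p n i j / a n) Filter.atTop (nhds (C i j)))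
    (hna : Filter.Tendsto (fun n : ℕ => (n : ℝ) * a n) Filter.atTop Filter.atTop)
    {U : Set ((𝒳 → ℝ) × (𝒳 × 𝒳 → ℝ))} (hU : IsOpen U) {ω : 𝒳 → ℝ}
    (hω : ∀ c, 0 ≤ ω c) (hωs : ∑ c, ω c = 1) (hωU : (ω, tensor C ω) ∈ U)
    {β : ℝ} (hβ : entropy μ ω < β) :
    ∀ᶠ n : ℕ in atTop, Real.exp (-(n * β)) ≤
      graphPr μ (p n) n {x | (L1 n x, L2 (a n) n x) ∈ U ∩ MSpace 𝒳} := by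
  obtain ⟨γ, hγ1, hγ2⟩ := exists_between hβ
  have hcont : Continuous fun y : (𝒳 → ℝ) × (𝒳 × 𝒳 → ℝ) => (y.1, y.2 + tensor C y.1) :=
    continuous_fst.prodMk (continuous_snd.add ((continuous_tensor C).comp continuous_fst))
  have hlin : Continuous fun y : (𝒳 → ℝ) × (𝒳 × 𝒳 → ℝ) =>
      ∑ c, y.1 c * Real.log (ω c / μ c) :=
    continuous_finsetSum _ fun c _ =>
      ((continuous_apply c).comp continuous_fst).mul continuous_const
  have hnhds := ((hcont.continuousAt (x := (ω, 0))).eventually_mem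
    (hU.mem_nhds (by simpa using hωU))).and
    ((hlin.continuousAt (x := (ω, 0))).eventually_lt_const (u := γ) hγ1)
  obtain ⟨ε, hε, hball⟩ := Metric.eventually_nhds_iff.1 hnhds
  set δ : ℝ := min 1 (ε / 2) with hδ
  have hδ0 : 0 < δ := by positivity
  have hδε : δ < ε := (min_le_right _ _).trans_lt (half_lt_self hε)
  have hgood : ∀ (ν : 𝒳 → ℝ) (ϖ : 𝒳 × 𝒳 → ℝ), (∀ c, |ν c - ω c| ≤ δ) →
      (∀ q, |ϖ q - tensor C ν q| ≤ δ) →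
      (ν, ϖ) ∈ U ∧ ∑ c, ν c * Real.log (ω c / μ c) ≤ γ := by
    intro ν ϖ h1 h2
    have h3 : dist (ν, ϖ - tensor C ν) (ω, (0 : 𝒳 × 𝒳 → ℝ)) < ε := by
      rw [Prod.dist_eq]
      refine (max_le ((dist_pi_le_iff hδ0.le).2 fun c => ?_)
        ((dist_pi_le_iff hδ0.le).2 fun q => ?_)).trans_lt hδε
      · rw [Real.dist_eq]
        exact h1 c
      · rw [Real.dist_eq]
        simpa using h2 q
    have h4 := hball h3
    simp only [sub_add_cancel] at h4
    exact ⟨h4.1, h4.2.le⟩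
  obtain ⟨c, hc, hdev⟩ := exists_graphPr_L2_dev_le hp0 hp1 hpsymm hapos hconv hδ0
  set D : ℝ := Fintype.card (𝒳 × 𝒳) * 2 with hD
  set D' : ℝ := Fintype.card 𝒳 * 2 with hD'
  have hD0 : 0 ≤ D := by positivity
  filter_upwards [hdev, (hna.const_mul_atTop hc).eventually_ge_atTop 1,
    eventually_mul_pow_mul_exp_le (4 * D) 0 one_pos,
    eventually_mul_pow_mul_exp_le (4 * D') 0 (c := δ ^ 2 / 4) (by positivity),
    eventually_mul_pow_mul_exp_le 2 0 (sub_pos.2 hγ2),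
    eventually_gt_atTop 0] with n h1 h2 h3 h4 h5 hn
  simp only [pow_zero, mul_one, one_mul] at h3 h4 h5
  let A : Set ((Fin n → 𝒳) × Finset (Fin n × Fin n)) :=
    {x | ∃ q : 𝒳 × 𝒳, δ < |L2 (a n) n x q - C q.1 q.2 * L1 n x q.1 * L1 n x q.2|}
  let B : Set ((Fin n → 𝒳) × Finset (Fin n × Fin n)) := {x | ∃ c, δ ≤ |L1 n x c - ω c|}
  let G : Set ((Fin n → 𝒳) × Finset (Fin n × Fin n)) := (A ∪ B)ᶜ
  have hG : ∀ x ∈ G, (L1 n x, L2 (a n) n x) ∈ U ∧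
      ∑ c, L1 n x c * Real.log (ω c / μ c) ≤ γ := by
    intro x hx
    simp only [G, A, B, Set.mem_compl_iff, Set.mem_union, Set.mem_ofPred_eq, not_or, not_exists,
      not_lt, not_le] at hx
    exact hgood _ _ (fun c => (hx.2 c).le) hx.1
  have hA : graphPr ω (p n) n A ≤ 1 / 4 := by
    refine (h1 ω hω hωs).trans ?_
    have : Real.exp (-c * (n ^ 2 * a n)) ≤ Real.exp (-(n:ℝ)) := by
      apply Real.exp_le_exp.2
      have := mul_le_mul_of_nonneg_left h2 (Nat.cast_nonneg (α := ℝ) n)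
      linarith
    have := mul_le_mul_of_nonneg_left this hD0
    rw [hD] at this h3
    linarith
  have hB : graphPr ω (p n) n B ≤ 1 / 4 := by
    refine (graphPr_L1_dev_le hω hωs (hp0 n) (hp1 n) hn hδ0.le (min_le_left _ _)).trans ?_
    rw [hD'] at h4
    rw [neg_mul]
    linarith
  have hG2 : 1 / 2 ≤ graphPr ω (p n) n G := by
    have e1 := graphPr_le_add hω (hp0 n) (hp1 n) (S := Set.univ) G (A ∪ B)
      (fun x _ => (em (x ∈ A ∪ B)).symm)
    have e2 := graphPr_le_add hω (hp0 n) (hp1 n) (S := A ∪ B) A B (fun x hx => hx)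
    rw [graphPr_univ ω hωs] at e1
    linarith
  calc Real.exp (-(n * β)) ≤ Real.exp (-(n * γ)) * (1 / 2) := by
        have : Real.exp (-(n * β)) = Real.exp (-((β - γ) * n)) * Real.exp (-(n * γ)) := by
          rw [← Real.exp_add]
          congr 1
          ring
        rw [this, mul_comm (Real.exp (-(n * γ)))]
        exact mul_le_mul_of_nonneg_right (by linarith) (Real.exp_pos _).le
    _ ≤ Real.exp (-(n * γ)) * graphPr ω (p n) n G :=
        mul_le_mul_of_nonneg_left hG2 (Real.exp_pos _).le
    _ ≤ graphPr μ (p n) n G :=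
        exp_mul_graphPr_le hμ0 hω (hp0 n) (hp1 n) hn fun x hx => (hG x hx).2
    _ ≤ _ := by
        unfold graphPr
        refine Finset.sum_le_sum fun x _ => Set.indicator_le_indicator_of_subset ?_
          (graphWeight_nonneg (fun c => (hμ0 c).le) (hp0 n) (hp1 n) n) x
        exact fun x hx => ⟨(hG x hx).1, L1_L2_mem_MSpace hn (hapos n) x⟩

end CRG

/-- **LDP for (L¹,L²) in the supercritical regime at speed `n`** (Theorem 2.4(ii)):
`(L¹,L²)` satisfies an LDP in `ℳ(𝒳) × ℳ̃_*(𝒳×𝒳)` with speed `n` and good rate function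
`I₂(ω,ϖ) = H(ω‖μ)` if `ϖ = Cω⊗ω` and `+∞` otherwise. -/
theorem ldp_supercritical_speed_n
    {𝒳 : Type} [Fintype 𝒳] [DecidableEq 𝒳] [Nonempty 𝒳]
    (μ : 𝒳 → ℝ) (hμ0 : ∀ a, 0 < μ a) (hμ1 : ∀ a, μ a ≤ 1) (hμs : ∑ a, μ a = 1)
    (p : ℕ → 𝒳 → 𝒳 → ℝ) (hp0 : ∀ n a b, 0 ≤ p n a b) (hp1 : ∀ n a b, p n a b ≤ 1)
    (hpsymm : ∀ n a b, p n a b = p n b a)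
    (C : 𝒳 → 𝒳 → ℝ) (hC0 : ∀ a b, 0 ≤ C a b) (hCsymm : ∀ a b, C a b = C b a)
    (a : ℕ → ℝ) (hapos : ∀ n, 0 < a n)
    (hconv : ∀ i j, Filter.Tendsto (fun n => p n i j / a n) Filter.atTop (nhds (C i j)))
    (ha0 : Filter.Tendsto a Filter.atTop (nhds 0))
    (hna : Filter.Tendsto (fun n : ℕ => (n : ℝ) * a n) Filter.atTop Filter.atTop)
    :
    LowerSemicontinuousOn (I2 μ C) (MSpace 𝒳) ∧
    (∀ c : ℝ, IsCompact {z | z ∈ MSpace 𝒳 ∧ I2 μ C z ≤ ENNReal.ofReal c}) ∧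
    (∀ F : Set ((𝒳 → ℝ) × (𝒳 × 𝒳 → ℝ)), F ⊆ MSpace 𝒳 → IsClosed F →
      Filter.limsup (fun n : ℕ => ((1 / (n:ℝ) : ℝ) : EReal) *
          elog (graphPr μ (p n) n {x | (L1 n x, L2 (a n) n x) ∈ F})) Filter.atTop
        ≤ - ⨅ z ∈ F, (I2 μ C z : EReal)) ∧
    (∀ U : Set ((𝒳 → ℝ) × (𝒳 × 𝒳 → ℝ)), IsOpen U →
      - ⨅ z ∈ U ∩ MSpace 𝒳, (I2 μ C z : EReal)
        ≤ Filter.liminf (fun n : ℕ => ((1 / (n:ℝ) : ℝ) : EReal) *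
          elog (graphPr μ (p n) n {x | (L1 n x, L2 (a n) n x) ∈ U ∩ MSpace 𝒳})) Filter.atTop) := by

  refine ⟨(lowerSemicontinuous_I2 hμ0 C).lowerSemicontinuousOn _,
    isCompact_sublevel_I2 hμ0 C, fun F hFM hF => ?_, fun U hU => ?_⟩
  · rw [EReal.le_neg]
    refine EReal.ge_of_forall_gt_iff_ge.1 fun β hβ => ?_
    obtain ⟨α, hβα, hα⟩ := EReal.lt_iff_exists_real_btwn.1 hβ
    rw [EReal.le_neg]
    refine Filter.limsup_le_of_le (by isBoundedDefault) ?_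
    filter_upwards [eventually_graphPr_le hμ0 hμs hp0 hp1 hpsymm hapos hconv hna hFM hF
      (EReal.coe_lt_coe_iff.1 hβα) (fun z hz => hα.trans_le (iInf₂_le z hz)),
      Filter.eventually_gt_atTop 0] with n hn hn0
    exact inv_mul_elog_le hn0 hn
  · rw [EReal.neg_le]
    refine le_iInf₂ fun z hz => ?_
    rw [EReal.neg_le]
    by_cases h : z.2 = tensor C z.1
    · rw [I2_of_eq hμ0 h, EReal.coe_ennreal_ofReal,
        max_eq_left (entropy_nonneg hμ0 hz.2.1 (hμs.trans hz.2.2.1.symm)), EReal.neg_le]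
      refine EReal.le_of_forall_lt_iff_le.1 fun β hβ => ?_
      rw [EReal.neg_le]
      refine Filter.le_liminf_of_le (by isBoundedDefault) ?_
      filter_upwards [eventually_le_graphPr hμ0 hp0 hp1 hpsymm hapos hconv hna hU hz.2.1 hz.2.2.1
        (by rw [← h]; exact hz.1) (EReal.coe_lt_coe_iff.1 hβ),
        Filter.eventually_gt_atTop 0] with n hn hn0
      exact le_inv_mul_elog hn0 hn
    · rw [I2_of_ne h]
      simp
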